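/- Let b, c, d, e, g ∈ ℂ with e and g not equal to a nonpositive integer. Then the function u(x,y) = F2(b,c,d;e;g;x,y) satisfies, at every point of D = {(x,y) ∈ ℝ² : 0 < x < 1, 0 < y}, the third-order partial differential equation y²·u_yyy + xy·u_xyy + gx·u_xy + (e+g+1)y·u_yy + (eg − y)·u_y − d·u = 0. -/

import Mathlib

noncomputable def poch (a : ℂ) (n : ℕ) : ℂ := ∏ i ∈ Finset.range n, (a + i)

noncomputable def pdx (u : ℝ → ℝ → ℂ) : ℝ → ℝ → ℂ := fun x y => deriv (fun t => u t y) x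
noncomputable def pdy (u : ℝ → ℝ → ℂ) : ℝ → ℝ → ℂ := fun x y => deriv (fun t => u x t) y

/-- Kampé de Fériet function of the third order. -/
noncomputable def F2 (b c d e g x y : ℂ) : ℂ :=
  ∑' p : ℕ × ℕ,
    poch b p.1 * poch c p.1 * poch d p.2 /
      (poch e (p.1 + p.2) * poch g p.2 * (Nat.factorial p.1 : ℂ) * (Nat.factorial p.2 : ℂ)) *
      x ^ p.1 * y ^ p.2

open Filter Topology

/-- Coefficients whose double power series converges for `‖x‖ < 1` and all `y`, expressed by
Cauchy-type bounds. -/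
def GoodCoeff (A : ℕ × ℕ → ℂ) : Prop :=
  ∀ r R : ℝ, 0 < r → r < 1 → 0 < R → ∃ C : ℝ, ∀ p : ℕ × ℕ, ‖A p‖ * r ^ p.1 * R ^ p.2 ≤ C

/-- The sum of the double power series with coefficients `A`. -/
noncomputable def doubleSeries (A : ℕ × ℕ → ℂ) (x y : ℂ) : ℂ :=
  ∑' p : ℕ × ℕ, A p * x ^ p.1 * y ^ p.2

/-- Coefficients of the formal partial derivative in the first variable. -/
def coeffDx (A : ℕ × ℕ → ℂ) : ℕ × ℕ → ℂ := fun p => ((p.1 : ℂ) + 1) * A (p.1 + 1, p.2)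

/-- Coefficients of the formal partial derivative in the second variable. -/
def coeffDy (A : ℕ × ℕ → ℂ) : ℕ × ℕ → ℂ := fun p => ((p.2 : ℂ) + 1) * A (p.1, p.2 + 1)

lemma exists_bound_of_eventually_succ_le {f : ℕ → ℝ} (h : ∀ᶠ k in atTop, f (k + 1) ≤ f k) :
    ∃ C, 0 < C ∧ ∀ k, f k ≤ C := by
  obtain ⟨N, hN⟩ := eventually_atTop.1 h
  obtain ⟨C, hC⟩ := ((Finset.range (N + 1)).image f).exists_le
  refine ⟨max C 1, by positivity, fun k => le_max_of_le_left ?_⟩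
  have hle : ∀ k, k ≤ N → f k ≤ C := fun k hk =>
    hC _ (Finset.mem_image_of_mem _ (Finset.mem_range.2 (by omega)))
  rcases le_total k N with hk | hk
  · exact hle k hk
  · induction k, hk using Nat.le_induction with
    | base => exact hle N le_rfl
    | succ k hk ih => exact (hN k hk).trans ih

lemma exists_bound_natCast_mul_pow {q : ℝ} (h0 : 0 ≤ q) (h1 : q < 1) :
    ∃ C : ℝ, ∀ k : ℕ, (k : ℝ) * q ^ k ≤ C := by
  obtain ⟨C, hC⟩ := (tendsto_self_mul_const_pow_of_lt_one h0 h1).bddAbove_range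
  exact ⟨C, fun k => hC ⟨k, rfl⟩⟩

lemma poch_succ (a : ℂ) (n : ℕ) : poch a (n + 1) = poch a n * (a + n) :=
  Finset.prod_range_succ _ _

lemma poch_ne_zero {a : ℂ} (ha : ∀ n : ℕ, a ≠ -(n : ℂ)) (n : ℕ) : poch a n ≠ 0 :=
  Finset.prod_ne_zero_iff.2 fun i _ h => ha i (eq_neg_of_add_eq_zero_left h)

lemma poch_upper (a : ℂ) {ρ : ℝ} (hρ : 1 < ρ) :
    ∃ C, 0 < C ∧ ∀ k : ℕ, ‖poch a k‖ ≤ C * (ρ ^ k * k.factorial) := by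
  have hρ0 : 0 < ρ := by linarith
  obtain ⟨C, hC0, hC⟩ := exists_bound_of_eventually_succ_le
    (f := fun k : ℕ => ‖poch a k‖ / (ρ ^ k * k.factorial)) (by
      filter_upwards [eventually_ge_atTop ⌈‖a‖ / (ρ - 1)⌉₊] with k hk
      have h1 : ‖a‖ ≤ k * (ρ - 1) := (div_le_iff₀ (by linarith)).1 (Nat.ceil_le.1 hk)
      have h2 : ‖a + k‖ ≤ ρ * (k + 1) := by
        have := norm_add_le a (k : ℂ)
        rw [Complex.norm_natCast] at this
        nlinarith
      rw [div_le_div_iff₀ (by positivity) (by positivity), poch_succ, norm_mul,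
        Nat.factorial_succ]
      push_cast
      calc ‖poch a k‖ * ‖a + k‖ * (ρ ^ k * k.factorial)
          ≤ ‖poch a k‖ * (ρ * (k + 1)) * (ρ ^ k * k.factorial) := by gcongr
        _ = _ := by ring)
  exact ⟨C, hC0, fun k => (div_le_iff₀ (by positivity)).1 (hC k)⟩

lemma poch_lower {a : ℂ} (ha : ∀ n : ℕ, a ≠ -(n : ℂ)) {ρ : ℝ} (hρ : 1 < ρ) :
    ∃ C, 0 < C ∧ ∀ k : ℕ, (k.factorial : ℝ) ≤ C * (ρ ^ k * ‖poch a k‖) := by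
  have hρ0 : 0 < ρ := by linarith
  have hp : ∀ k, 0 < ‖poch a k‖ := fun k => norm_pos_iff.2 (poch_ne_zero ha k)
  obtain ⟨C, hC0, hC⟩ := exists_bound_of_eventually_succ_le
    (f := fun k : ℕ => (k.factorial : ℝ) / (ρ ^ k * ‖poch a k‖)) (by
      filter_upwards [eventually_ge_atTop ⌈(ρ * ‖a‖ + 1) / (ρ - 1)⌉₊] with k hk
      have h1 : ρ * ‖a‖ + 1 ≤ k * (ρ - 1) := (div_le_iff₀ (by linarith)).1 (Nat.ceil_le.1 hk)
      have h2 : (k : ℝ) + 1 ≤ ρ * ‖a + k‖ := by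
        have := norm_sub_le (a + k) a
        rw [add_sub_cancel_left, Complex.norm_natCast] at this
        nlinarith
      have := hp k
      have := hp (k + 1)
      rw [div_le_div_iff₀ (by positivity) (by positivity), poch_succ, norm_mul,
        Nat.factorial_succ]
      push_cast
      calc ((k : ℝ) + 1) * k.factorial * (ρ ^ k * ‖poch a k‖)
          ≤ (ρ * ‖a + k‖) * k.factorial * (ρ ^ k * ‖poch a k‖) := by gcongr
        _ = _ := by ring)
  exact ⟨C, hC0, fun k =>
    (div_le_iff₀ (mul_pos (pow_pos hρ0 k) (hp k))).1 (hC k)⟩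

namespace GoodCoeff

variable {A : ℕ × ℕ → ℂ}

lemma summable_norm (hA : GoodCoeff A) {r R : ℝ} (hr0 : 0 ≤ r) (hr1 : r < 1) (hR : 0 ≤ R) :
    Summable fun p : ℕ × ℕ => ‖A p‖ * r ^ p.1 * R ^ p.2 := by
  obtain ⟨s, hrs, hs1⟩ := exists_between hr1
  have hs0 : 0 < s := by linarith
  have hT : 0 < R + 1 := by linarith
  obtain ⟨C, hC⟩ := hA s (R + 1) hs0 hs1 hT
  have hsum : Summable fun p : ℕ × ℕ => (r / s) ^ p.1 * (R / (R + 1)) ^ p.2 :=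
    (summable_geometric_of_lt_one (by positivity) ((div_lt_one hs0).2 hrs)).mul_of_nonneg
      (summable_geometric_of_lt_one (by positivity) ((div_lt_one hT).2 (by linarith)))
      (fun _ => by positivity) (fun _ => by positivity)
  refine Summable.of_nonneg_of_le (fun p => by positivity) (fun p => ?_) (hsum.mul_left C)
  calc ‖A p‖ * r ^ p.1 * R ^ p.2
      = (‖A p‖ * s ^ p.1 * (R + 1) ^ p.2) * ((r / s) ^ p.1 * (R / (R + 1)) ^ p.2) := by
        rw [div_pow, div_pow]; field_simp
    _ ≤ _ := by gcongr; exact hC p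

lemma hasSum (hA : GoodCoeff A) {x : ℂ} (hx : ‖x‖ < 1) (y : ℂ) :
    HasSum (fun p : ℕ × ℕ => A p * x ^ p.1 * y ^ p.2) (doubleSeries A x y) := by
  refine Summable.hasSum (Summable.of_norm ?_)
  simpa using hA.summable_norm (norm_nonneg x) hx (norm_nonneg y)

lemma fst_mul (hA : GoodCoeff A) : GoodCoeff fun p => (p.1 : ℂ) * A p := by
  intro r R hr0 hr1 hR
  obtain ⟨s, hrs, hs1⟩ := exists_between hr1
  have hs0 : 0 < s := by linarith
  obtain ⟨C, hC⟩ := hA s R hs0 hs1 hR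
  obtain ⟨K, hK⟩ := exists_bound_natCast_mul_pow (q := r / s) (by positivity)
    ((div_lt_one hs0).2 hrs)
  have hK0 : 0 ≤ K := le_trans (by simp) (hK 0)
  refine ⟨K * C, fun p => ?_⟩
  calc ‖(p.1 : ℂ) * A p‖ * r ^ p.1 * R ^ p.2
      = (p.1 * (r / s) ^ p.1) * (‖A p‖ * s ^ p.1 * R ^ p.2) := by
        rw [norm_mul, Complex.norm_natCast, div_pow]; field_simp
    _ ≤ K * C := mul_le_mul (hK _) (hC p) (by positivity) hK0

lemma snd_mul (hA : GoodCoeff A) : GoodCoeff fun p => (p.2 : ℂ) * A p := by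
  intro r R hr0 hr1 hR
  obtain ⟨C, hC⟩ := hA r (R + 1) hr0 hr1 (by linarith)
  obtain ⟨K, hK⟩ := exists_bound_natCast_mul_pow (q := R / (R + 1)) (by positivity)
    ((div_lt_one (by linarith)).2 (by linarith))
  have hK0 : 0 ≤ K := le_trans (by simp) (hK 0)
  refine ⟨K * C, fun p => ?_⟩
  calc ‖(p.2 : ℂ) * A p‖ * r ^ p.1 * R ^ p.2
      = (p.2 * (R / (R + 1)) ^ p.2) * (‖A p‖ * r ^ p.1 * (R + 1) ^ p.2) := by
        rw [norm_mul, Complex.norm_natCast, div_pow]; field_simp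
    _ ≤ K * C := mul_le_mul (hK _) (hC p) (by positivity) hK0

lemma coeffDx (hA : GoodCoeff A) : GoodCoeff (coeffDx A) := by
  intro r R hr0 hr1 hR
  obtain ⟨C, hC⟩ := hA.fst_mul r R hr0 hr1 hR
  refine ⟨C / r, fun p => (le_div_iff₀ hr0).2 ?_⟩
  refine le_trans (le_of_eq ?_) (hC (p.1 + 1, p.2))
  simp only [_root_.coeffDx]
  push_cast
  ring

lemma coeffDy (hA : GoodCoeff A) : GoodCoeff (coeffDy A) := by
  intro r R hr0 hr1 hR
  obtain ⟨C, hC⟩ := hA.snd_mul r R hr0 hr1 hR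
  refine ⟨C / R, fun p => (le_div_iff₀ hR).2 ?_⟩
  refine le_trans (le_of_eq ?_) (hC (p.1, p.2 + 1))
  simp only [_root_.coeffDy]
  push_cast
  ring

end GoodCoeff

lemma tsum_fst_deriv (A : ℕ × ℕ → ℂ) (x y : ℂ) :
    ∑' p : ℕ × ℕ, A p * (p.1 * x ^ (p.1 - 1)) * y ^ p.2 = doubleSeries (coeffDx A) x y := by
  have hinj : Function.Injective fun p : ℕ × ℕ => (p.1 + 1, p.2) := by
    rintro ⟨a, b⟩ ⟨c, d⟩ h
    simpa using h
  rw [← hinj.tsum_eq]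
  · refine tsum_congr fun p => ?_
    simp only [coeffDx, Nat.add_sub_cancel]
    push_cast
    ring
  · rintro ⟨_ | m, n⟩ h
    · simp at h
    · exact ⟨(m, n), rfl⟩

lemma tsum_snd_deriv (A : ℕ × ℕ → ℂ) (x y : ℂ) :
    ∑' p : ℕ × ℕ, A p * x ^ p.1 * (p.2 * y ^ (p.2 - 1)) = doubleSeries (coeffDy A) x y := by
  have hinj : Function.Injective fun p : ℕ × ℕ => (p.1, p.2 + 1) := by
    rintro ⟨a, b⟩ ⟨c, d⟩ h
    simpa using h
  rw [← hinj.tsum_eq]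
  · refine tsum_congr fun p => ?_
    simp only [coeffDy, Nat.add_sub_cancel]
    push_cast
    ring
  · rintro ⟨m, _ | n⟩ h
    · simp at h
    · exact ⟨(m, n), rfl⟩

lemma mul_doubleSeries_coeffDx (A : ℕ × ℕ → ℂ) (x y : ℂ) :
    x * doubleSeries (coeffDx A) x y = doubleSeries (fun p => (p.1 : ℂ) * A p) x y := by
  rw [← tsum_fst_deriv, ← tsum_mul_left]
  refine tsum_congr fun ⟨m, n⟩ => ?_
  cases m with
  | zero => simp
  | succ m => simp only [Nat.add_sub_cancel]; ring

lemma mul_doubleSeries_coeffDy (A : ℕ × ℕ → ℂ) (x y : ℂ) :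
    y * doubleSeries (coeffDy A) x y = doubleSeries (fun p => (p.2 : ℂ) * A p) x y := by
  rw [← tsum_snd_deriv, ← tsum_mul_left]
  refine tsum_congr fun ⟨m, n⟩ => ?_
  cases n with
  | zero => simp
  | succ n => simp only [Nat.add_sub_cancel]; ring

lemma norm_natCast_mul_pow_pred_le {t : ℂ} {r : ℝ} (hr : 0 < r) (ht : ‖t‖ ≤ r) (n : ℕ) :
    ‖(n : ℂ) * t ^ (n - 1)‖ ≤ r⁻¹ * (n * r ^ n) := by
  cases n with
  | zero => simp
  | succ n =>
    rw [norm_mul, Complex.norm_natCast, norm_pow, Nat.add_sub_cancel, pow_succ]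
    calc ((n + 1 : ℕ) : ℝ) * ‖t‖ ^ n ≤ ((n + 1 : ℕ) : ℝ) * r ^ n := by gcongr
      _ = _ := by field_simp

lemma GoodCoeff.hasDerivAt_fst {A : ℕ × ℕ → ℂ} (hA : GoodCoeff A) {x : ℂ} (hx : ‖x‖ < 1)
    (y : ℂ) :
    HasDerivAt (fun t => doubleSeries A t y) (doubleSeries (_root_.coeffDx A) x y) x := by
  obtain ⟨r, hxr, hr1⟩ := exists_between hx
  have hr0 : 0 < r := (norm_nonneg x).trans_lt hxr
  rw [← tsum_fst_deriv]
  have hsum := (hA.fst_mul.summable_norm hr0.le hr1 (norm_nonneg y)).mul_left r⁻¹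
  refine hasDerivAt_tsum_of_isPreconnected (t := Metric.ball 0 r) (y₀ := x)
    (g := fun (p : ℕ × ℕ) (t : ℂ) => A p * t ^ p.1 * y ^ p.2)
    (g' := fun (p : ℕ × ℕ) (t : ℂ) => A p * (p.1 * t ^ (p.1 - 1)) * y ^ p.2)
    hsum Metric.isOpen_ball (convex_ball _ _).isPreconnected (fun p t _ => ?_) (fun p t ht => ?_)
    (by simpa using hxr) (hA.hasSum hx y).summable (by simpa using hxr)
  · exact ((hasDerivAt_pow p.1 t).const_mul (A p)).mul_const (y ^ p.2)
  · have h := norm_natCast_mul_pow_pred_le hr0 (mem_ball_zero_iff.1 ht).le p.1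
    rw [norm_mul, norm_mul, norm_pow]
    calc ‖A p‖ * ‖(p.1 : ℂ) * t ^ (p.1 - 1)‖ * ‖y‖ ^ p.2
        ≤ ‖A p‖ * (r⁻¹ * (p.1 * r ^ p.1)) * ‖y‖ ^ p.2 := by gcongr
      _ = _ := by rw [norm_mul, Complex.norm_natCast]; ring

lemma GoodCoeff.hasDerivAt_snd {A : ℕ × ℕ → ℂ} (hA : GoodCoeff A) {x : ℂ} (hx : ‖x‖ < 1)
    (y : ℂ) :
    HasDerivAt (fun t => doubleSeries A x t) (doubleSeries (_root_.coeffDy A) x y) y := by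
  obtain ⟨r, hyr⟩ := exists_gt ‖y‖
  have hr0 : 0 < r := (norm_nonneg y).trans_lt hyr
  rw [← tsum_snd_deriv]
  have hsum := (hA.snd_mul.summable_norm (norm_nonneg x) hx hr0.le).mul_left r⁻¹
  refine hasDerivAt_tsum_of_isPreconnected (t := Metric.ball 0 r) (y₀ := y)
    (g := fun (p : ℕ × ℕ) (t : ℂ) => A p * x ^ p.1 * t ^ p.2)
    (g' := fun (p : ℕ × ℕ) (t : ℂ) => A p * x ^ p.1 * (p.2 * t ^ (p.2 - 1)))
    hsum Metric.isOpen_ball (convex_ball _ _).isPreconnected (fun p t _ => ?_) (fun p t ht => ?_)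
    (by simpa using hyr) (hA.hasSum hx y).summable (by simpa using hyr)
  · exact (hasDerivAt_pow p.2 t).const_mul (A p * x ^ p.1)
  · have h := norm_natCast_mul_pow_pred_le hr0 (mem_ball_zero_iff.1 ht).le p.2
    rw [norm_mul, norm_mul, norm_pow]
    calc ‖A p‖ * ‖x‖ ^ p.1 * ‖(p.2 : ℂ) * t ^ (p.2 - 1)‖
        ≤ ‖A p‖ * ‖x‖ ^ p.1 * (r⁻¹ * (p.2 * r ^ p.2)) := by gcongr
      _ = _ := by rw [norm_mul, Complex.norm_natCast]; ring

lemma pdx_eq_doubleSeries {A : ℕ × ℕ → ℂ} (hA : GoodCoeff A) {x : ℝ} (hx : ‖(x : ℂ)‖ < 1)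
    (y : ℝ) :
    pdx (fun s t : ℝ => doubleSeries A s t) x y = doubleSeries (coeffDx A) x y :=
  (hA.hasDerivAt_fst hx y).comp_ofReal.deriv

lemma pdy_eq_doubleSeries {A : ℕ × ℕ → ℂ} (hA : GoodCoeff A) {x : ℝ} (hx : ‖(x : ℂ)‖ < 1)
    {v : ℝ → ℝ → ℂ} (hv : ∀ t : ℝ, v x t = doubleSeries A x t) (y : ℝ) :
    pdy v x y = doubleSeries (coeffDy A) x y := by
  simp only [pdy, hv]
  exact (hA.hasDerivAt_snd hx y).comp_ofReal.deriv

/-- Coefficients of the Kampé de Fériet series `F2`. -/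
noncomputable def coeffF2 (b c d e g : ℂ) (p : ℕ × ℕ) : ℂ :=
  poch b p.1 * poch c p.1 * poch d p.2 /
    (poch e (p.1 + p.2) * poch g p.2 * (Nat.factorial p.1 : ℂ) * (Nat.factorial p.2 : ℂ))

lemma goodCoeff_coeffF2 (b c d : ℂ) {e g : ℂ} (he : ∀ n : ℕ, e ≠ -(n : ℂ))
    (hg : ∀ n : ℕ, g ≠ -(n : ℂ)) : GoodCoeff (coeffF2 b c d e g) := by
  intro r R hr0 hr1 hR
  obtain ⟨ρ, hρ1, hρr⟩ : ∃ ρ : ℝ, 1 < ρ ∧ ρ ^ 3 * r ≤ 1 := by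
    have hcont : ContinuousAt (fun ρ : ℝ => ρ ^ 3 * r) 1 := by fun_prop
    have hev : ∀ᶠ ρ in 𝓝[>] (1 : ℝ), ρ ^ 3 * r < 1 :=
      (hcont.eventually_lt_const (by simpa using hr1)).filter_mono nhdsWithin_le_nhds
    obtain ⟨ρ, h1, h2⟩ := (hev.and self_mem_nhdsWithin).exists
    exact ⟨ρ, h2, h1.le⟩
  have hρ0 : 0 < ρ := by linarith
  obtain ⟨B, hB0, hB⟩ := poch_upper b hρ1
  obtain ⟨C, hC0, hC⟩ := poch_upper c hρ1
  obtain ⟨D, hD0, hD⟩ := poch_upper d hρ1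
  obtain ⟨E, hE0, hE⟩ := poch_lower he hρ1
  obtain ⟨G, hG0, hG⟩ := poch_lower hg hρ1
  refine ⟨B * C * D * E * G * Real.exp (ρ ^ 3 * R), fun ⟨m, n⟩ => ?_⟩
  have hem : 0 < ‖poch e (m + n)‖ := norm_pos_iff.2 (poch_ne_zero he _)
  have hgn : 0 < ‖poch g n‖ := norm_pos_iff.2 (poch_ne_zero hg _)
  have hfac : (m.factorial : ℝ) * n.factorial ≤ (m + n).factorial := by
    exact_mod_cast Nat.le_of_dvd (Nat.factorial_pos _)
      (Nat.factorial_mul_factorial_dvd_factorial_add m n)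
  have hexp : (ρ ^ 3 * R) ^ n / n.factorial ≤ Real.exp (ρ ^ 3 * R) :=
    Real.pow_div_factorial_le_exp _ (by positivity) n
  have hn1 : (1 : ℝ) ≤ n.factorial := by exact_mod_cast Nat.factorial_pos n
  have hcoeff : ‖coeffF2 b c d e g (m, n)‖ ≤
      B * C * D * E * G * ((ρ ^ 3) ^ m * (ρ ^ 3) ^ n / n.factorial) := by
    simp only [coeffF2, norm_div, norm_mul, Complex.norm_natCast]
    rw [div_le_iff₀ (by positivity)]
    calc ‖poch b m‖ * ‖poch c m‖ * ‖poch d n‖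
        ≤ (B * (ρ ^ m * m.factorial)) * (C * (ρ ^ m * m.factorial)) *
          (D * (ρ ^ n * n.factorial)) := by
          gcongr
          exacts [hB m, hC m, hD n]
      _ = B * C * D * (ρ ^ m * ρ ^ m * ρ ^ n) * m.factorial *
          (m.factorial * n.factorial) * 1 := by ring
      _ ≤ B * C * D * (ρ ^ m * ρ ^ m * ρ ^ n) * m.factorial *
          (E * (ρ ^ (m + n) * ‖poch e (m + n)‖)) * (G * (ρ ^ n * ‖poch g n‖)) :=
          mul_le_mul (mul_le_mul_of_nonneg_left (hfac.trans (hE _)) (by positivity))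
            (hn1.trans (hG n)) zero_le_one (by positivity)
      _ = _ := by
          field_simp
          ring
  calc ‖coeffF2 b c d e g (m, n)‖ * r ^ m * R ^ n
      ≤ B * C * D * E * G * ((ρ ^ 3) ^ m * (ρ ^ 3) ^ n / n.factorial) * r ^ m * R ^ n := by
        gcongr
    _ = B * C * D * E * G * ((ρ ^ 3 * r) ^ m * ((ρ ^ 3 * R) ^ n / n.factorial)) := by
        rw [mul_pow _ r, mul_pow _ R]; ring
    _ ≤ B * C * D * E * G * (1 * Real.exp (ρ ^ 3 * R)) := by
        gcongr
        exact pow_le_one₀ (by positivity) hρr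
    _ = _ := by ring

lemma coeffF2_recurrence (b c d : ℂ) {e g : ℂ} (he : ∀ n : ℕ, e ≠ -(n : ℂ))
    (hg : ∀ n : ℕ, g ≠ -(n : ℂ)) (p : ℕ × ℕ) :
    (p.2 + g) * (p.2 + p.1 + e) * coeffDy (coeffF2 b c d e g) p =
      (p.2 + d) * coeffF2 b c d e g p := by
  obtain ⟨m, n⟩ := p
  have h1 := poch_ne_zero he (m + n)
  have h2 := poch_ne_zero hg n
  have h3 : e + ((m + n : ℕ) : ℂ) ≠ 0 := fun h => he _ (eq_neg_of_add_eq_zero_left h)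
  have h4 : g + (n : ℂ) ≠ 0 := fun h => hg _ (eq_neg_of_add_eq_zero_left h)
  have h5 : (n : ℂ) + 1 ≠ 0 := by exact_mod_cast n.succ_ne_zero
  have h6 : (m.factorial : ℂ) ≠ 0 := by exact_mod_cast m.factorial_ne_zero
  have h7 : (n.factorial : ℂ) ≠ 0 := by exact_mod_cast n.factorial_ne_zero
  simp only [coeffDy, coeffF2, ← add_assoc, poch_succ, Nat.factorial_succ]
  push_cast at h3 ⊢
  field_simp
  ring

theorem stmt5 (b c d e g : ℂ)
    (he : ∀ n : ℕ, e ≠ -(n : ℂ)) (hg : ∀ n : ℕ, g ≠ -(n : ℂ))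
    (u : ℝ → ℝ → ℂ)
    (hu : u = fun x y : ℝ => F2 b c d e g (x : ℂ) (y : ℂ)) :
    ∀ x y : ℝ, 0 < x → x < 1 → 0 < y →
      (y : ℂ) ^ 2 * pdy (pdy (pdy u)) x y + (x : ℂ) * (y : ℂ) * pdy (pdy (pdx u)) x y
        + g * (x : ℂ) * pdy (pdx u) x y + (e + g + 1) * (y : ℂ) * pdy (pdy u) x y
        + (e * g - (y : ℂ)) * pdy u x y - d * u x y = 0 := by
  intro x y hx0 hx1 _
  have hx : ‖(x : ℂ)‖ < 1 := by
    rwa [Complex.norm_real, Real.norm_of_nonneg hx0.le]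
  set A := coeffF2 b c d e g
  have hA : GoodCoeff A := goodCoeff_coeffF2 b c d he hg
  replace hu : u = fun s t : ℝ => doubleSeries A s t := hu
  set B := coeffDy A with hBdef
  have hB : GoodCoeff B := hA.coeffDy
  have hy := pdy_eq_doubleSeries hA hx (v := u) fun t => by rw [hu]
  have hyy := pdy_eq_doubleSeries hB hx hy
  have hyyy := pdy_eq_doubleSeries hB.coeffDy hx hyy
  have hxx := fun t => (congrArg (fun v => pdx v x t) hu).trans (pdx_eq_doubleSeries hA hx t)
  have hxy := pdy_eq_doubleSeries hA.coeffDx hx hxx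
  have hxyy := pdy_eq_doubleSeries hA.coeffDx.coeffDy hx hxy
  have hcomm : coeffDy (coeffDx A) = coeffDx B := by
    funext p
    simp only [hBdef, coeffDx, coeffDy]
    ring
  have hsnd : (fun p : ℕ × ℕ => (p.2 : ℂ) * coeffDy B p) =
      coeffDy fun p => ((p.2 : ℂ) - 1) * B p := by
    funext p
    simp only [coeffDy]
    push_cast
    ring
  have hfst : coeffDy (coeffDx B) = coeffDx (coeffDy B) := by
    funext p
    simp only [coeffDx, coeffDy]
    ring
  have hfst' : (fun p : ℕ × ℕ => (p.1 : ℂ) * coeffDy B p) =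
      coeffDy fun p => (p.1 : ℂ) * B p := by
    funext p
    simp only [coeffDy]
    ring
  have e1 : (y : ℂ) ^ 2 * doubleSeries (coeffDy (coeffDy B)) x y =
      doubleSeries (fun p => (p.2 : ℂ) * (((p.2 : ℂ) - 1) * B p)) x y := by
    rw [pow_two, mul_assoc, mul_doubleSeries_coeffDy, hsnd, mul_doubleSeries_coeffDy]
  have e2 : (x : ℂ) * y * doubleSeries (coeffDy (coeffDx B)) x y =
      doubleSeries (fun p => (p.2 : ℂ) * ((p.1 : ℂ) * B p)) x y := by
    rw [hfst, mul_comm (x : ℂ), mul_assoc, mul_doubleSeries_coeffDx, hfst',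
      mul_doubleSeries_coeffDy]
  have e3 := mul_doubleSeries_coeffDx B x y
  have e4 := mul_doubleSeries_coeffDy B x y
  have e5 := mul_doubleSeries_coeffDy A x y
  rw [← hBdef] at e5
  have e6 : doubleSeries (fun p => (p.2 : ℂ) * (((p.2 : ℂ) - 1) * B p)) x y =
      doubleSeries (fun p => (p.2 : ℂ) * ((p.2 : ℂ) * B p)) x y -
        doubleSeries (fun p => (p.2 : ℂ) * B p) x y := by
    rw [← ((hB.snd_mul.snd_mul.hasSum hx y).sub (hB.snd_mul.hasSum hx y)).tsum_eq]
    refine tsum_congr fun p => ?_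
    ring
  have hsum := ((((((hB.snd_mul.snd_mul.hasSum hx y).add (hB.fst_mul.snd_mul.hasSum hx y)).add
    ((hB.fst_mul.hasSum hx y).mul_left g)).add
    ((hB.snd_mul.hasSum hx y).mul_left (e + g))).add
    ((hB.hasSum hx y).mul_left (e * g))).sub (hA.snd_mul.hasSum hx y)).sub
    ((hA.hasSum hx y).mul_left d)
  have hzero := hsum.tsum_eq.symm.trans ((tsum_congr fun p => ?_).trans tsum_zero)
  · rw [hyyy, hxyy, hxy, hyy, hy, hcomm, e1, e2, e6, hu]
    linear_combination hzero + g * e3 + (e + g + 1) * e4 - e5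
  · linear_combination (x : ℂ) ^ p.1 * (y : ℂ) ^ p.2 * coeffF2_recurrence b c d he hg p
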